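/- arXiv:2506.20820 — 2 statements merged into one kernel-verified Lean document; each statement's English description precedes it below -/
import Mathlib

section
/- The element α = 1² + 1² + 1² + (2+√6)² + ((√6+√10)/2)² + (1+(√6+√10)/2)² in the ring of integers of Q(√6, √10) has length exactly 6, i.e., it is a sum of six squares but not of five squares of algebraic integers of Q(√6, √10). -/
open scoped Classical

noncomputable section

/-- `α` is a sum of `n` squares of elements of `S ⊆ ℝ`. -/
def SumOfSquaresLen (S : Set ℝ) (n : ℕ) (α : ℝ) : Prop :=
  ∃ x : Fin n → ℝ, (∀ i, x i ∈ S) ∧ α = ∑ i, x i ^ 2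

/-- The length of `α` as a sum of squares of elements of `S` (∞ if not a sum of squares). -/
def sqLength (S : Set ℝ) (α : ℝ) : ℕ∞ :=
  sInf {n : ℕ∞ | ∃ k : ℕ, n = (k : ℕ∞) ∧ SumOfSquaresLen S k α}

/-- The Pythagoras number of `S ⊆ ℝ`. -/
def pythagorasNumber (S : Set ℝ) : ℕ∞ :=
  sSup {n : ℕ∞ | ∃ α : ℝ, (∃ k : ℕ, SumOfSquaresLen S k α) ∧ n = sqLength S α}

/-- The biquadratic field `ℚ(√p, √q)` as a subfield of `ℝ`. -/
def biquadField (p q : ℝ) : IntermediateField ℚ ℝ :=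
  IntermediateField.adjoin ℚ {Real.sqrt p, Real.sqrt q}

/-- The ring of integers of `ℚ(√p, √q)`, viewed as a subset of `ℝ`. -/
def ringOfInt (p q : ℝ) : Set ℝ :=
  {x : ℝ | x ∈ biquadField p q ∧ IsIntegral ℤ x}

def dot5 (u v : Fin 5 → ℤ) : ℤ := ∑ i, u i * v i

lemma dot5_cs (u v : Fin 5 → ℤ) : (dot5 u v)^2 ≤ dot5 u u * dot5 v v := by
  have := Finset.sum_mul_sq_le_sq_mul_sq Finset.univ u v
  simpa [dot5, pow_two] using this

lemma dot5_nn (u : Fin 5 → ℤ) : 0 ≤ dot5 u u :=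
  Finset.sum_nonneg fun i _ => mul_self_nonneg _

lemma parity4 (a b c d x y z w : ℤ) (h1 : a*a+b*b+c*c+d*d = 4) (h2 : x*x+y*y+z*z+w*w = 2)
    (h3 : a*x+b*y+c*z+d*w = 1) : False := by
  have par : ∀ t : ℤ, ∃ k, (t = 2*k ∧ ∃ m, t*t = 4*m) ∨ (t = 2*k+1 ∧ ∃ m, t*t = 4*m+1) := by
    intro t
    obtain ⟨k, hk | hk⟩ := Int.even_or_odd' t
    · exact ⟨k, Or.inl ⟨hk, k*k, by rw [hk]; ring⟩⟩
    · exact ⟨k, Or.inr ⟨hk, k*k+k, by rw [hk]; ring⟩⟩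
  have hs : ∀ t : ℤ, ∃ m, t*t = t + 2*m := by
    intro t
    obtain ⟨k, hk | hk⟩ := Int.even_or_odd' t
    · exact ⟨2*k*k-k, by rw [hk]; ring⟩
    · exact ⟨2*k*k+k, by rw [hk]; ring⟩
  obtain ⟨x', hx⟩ := hs x
  obtain ⟨y', hy⟩ := hs y
  obtain ⟨z', hz⟩ := hs z
  obtain ⟨w', hw⟩ := hs w
  obtain ⟨ka, ⟨ha, ma, ha'⟩ | ⟨ha, ma, ha'⟩⟩ := par a <;>
  obtain ⟨kb, ⟨hb, mb, hb'⟩ | ⟨hb, mb, hb'⟩⟩ := par b <;>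
  obtain ⟨kc, ⟨hc, mc, hc'⟩ | ⟨hc, mc, hc'⟩⟩ := par c <;>
  obtain ⟨kd, ⟨hd, md, hd'⟩ | ⟨hd, md, hd'⟩⟩ := par d <;>
  first
  | omega
  | (rw [ha, hb, hc, hd] at h3
     have h4 : 2*(ka*x+kb*y+kc*z+kd*w) = 1 := by linarith
     omega)
  | (rw [ha, hb, hc, hd] at h3
     have h4 : 2*(ka*x+kb*y+kc*z+kd*w) + (x+y+z+w) = 1 := by linarith
     omega)

lemma unit5 (E A D : Fin 5 → ℤ) (hE : dot5 E E = 1) (hAE : dot5 A E = 0) (hDE : dot5 D E = 0)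
    (hA : dot5 A A = 4) (hD : dot5 D D = 2) (hAD : dot5 A D = 1) : False := by
  simp only [dot5, Fin.sum_univ_five] at *
  have sq : ∀ t : ℤ, t = 0 ∨ 1 ≤ t*t := by
    intro t
    by_cases h : t = 0
    · exact Or.inl h
    · right; have := mul_self_pos.mpr h; omega
  have nn : ∀ t : ℤ, 0 ≤ t*t := fun t => mul_self_nonneg t
  have n0 := nn (E 0)
  have n1 := nn (E 1)
  have n2 := nn (E 2)
  have n3 := nn (E 3)
  have n4 := nn (E 4)
  have key : ∀ s t : ℤ, t * s = 0 → s ≠ 0 → t = 0 := by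
    intro s t h hs
    exact (mul_eq_zero.mp h).resolve_right hs
  rcases sq (E 0) with h0 | h0 <;> rcases sq (E 1) with h1 | h1 <;>
  rcases sq (E 2) with h2 | h2 <;> rcases sq (E 3) with h3 | h3 <;>
  rcases sq (E 4) with h4 | h4 <;>
  first
  | (exfalso; linarith)
  | (exfalso; simp only [h0, h1, h2, h3, h4] at hE; norm_num at hE; done)
  | (simp only [h0, h1, h2, h3, mul_zero, zero_add] at *
     have hz : E 4 ≠ 0 := by rintro h; rw [h] at hE; omega
     have e1 := key _ _ hAE hz
     have e2 := key _ _ hDE hz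
     rw [e1] at hA hAD; rw [e2] at hD
     exact parity4 (A 0) (A 1) (A 2) (A 3) (D 0) (D 1) (D 2) (D 3) (by linarith) (by linarith) (by linarith))
  | (simp only [h0, h1, h2, h4, mul_zero, zero_add, add_zero] at *
     have hz : E 3 ≠ 0 := by rintro h; rw [h] at hE; omega
     have e1 := key _ _ hAE hz
     have e2 := key _ _ hDE hz
     rw [e1] at hA hAD; rw [e2] at hD
     exact parity4 (A 0) (A 1) (A 2) (A 4) (D 0) (D 1) (D 2) (D 4) (by linarith) (by linarith) (by linarith))
  | (simp only [h0, h1, h3, h4, mul_zero, zero_add, add_zero] at *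
     have hz : E 2 ≠ 0 := by rintro h; rw [h] at hE; omega
     have e1 := key _ _ hAE hz
     have e2 := key _ _ hDE hz
     rw [e1] at hA hAD; rw [e2] at hD
     exact parity4 (A 0) (A 1) (A 3) (A 4) (D 0) (D 1) (D 3) (D 4) (by linarith) (by linarith) (by linarith))
  | (simp only [h0, h2, h3, h4, mul_zero, zero_add, add_zero] at *
     have hz : E 1 ≠ 0 := by rintro h; rw [h] at hE; omega
     have e1 := key _ _ hAE hz
     have e2 := key _ _ hDE hz
     rw [e1] at hA hAD; rw [e2] at hD
     exact parity4 (A 0) (A 2) (A 3) (A 4) (D 0) (D 2) (D 3) (D 4) (by linarith) (by linarith) (by linarith))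
  | (simp only [h1, h2, h3, h4, mul_zero, zero_add, add_zero] at *
     have hz : E 0 ≠ 0 := by rintro h; rw [h] at hE; omega
     have e1 := key _ _ hAE hz
     have e2 := key _ _ hDE hz
     rw [e1] at hA hAD; rw [e2] at hD
     exact parity4 (A 1) (A 2) (A 3) (A 4) (D 1) (D 2) (D 3) (D 4) (by linarith) (by linarith) (by linarith))

lemma dot5_zero {u : Fin 5 → ℤ} (v : Fin 5 → ℤ) (h : dot5 u u = 0) : dot5 u v = 0 := by
  have := dot5_cs u v
  rw [h, zero_mul] at this
  nlinarith

/-- bilinear expansion -/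
lemma dot5_comb (m n k l : ℤ) (u v x y : Fin 5 → ℤ) :
    dot5 (fun i => m * u i + n * v i) (fun i => k * x i + l * y i)
      = m*k*dot5 u x + m*l*dot5 u y + n*k*dot5 v x + n*l*dot5 v y := by
  simp only [dot5, Fin.sum_univ_five]; ring

lemma dot5_comm (u v : Fin 5 → ℤ) : dot5 u v = dot5 v u := by
  simp only [dot5, mul_comm]

/-- CS for combos -/
lemma dot5_csc (m k l : ℤ) (u v x y : Fin 5 → ℤ) (n : ℤ) :
    (m*k*dot5 u x + m*l*dot5 u y + n*k*dot5 v x + n*l*dot5 v y)^2 ≤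
     (m*m*dot5 u u + 2*m*n*dot5 u v + n*n*dot5 v v) *
     (k*k*dot5 x x + 2*k*l*dot5 x y + l*l*dot5 y y) := by
  have := dot5_cs (fun i => m * u i + n * v i) (fun i => k * x i + l * y i)
  rw [dot5_comb, dot5_comb, dot5_comb, dot5_comm v u, dot5_comm y x] at this
  refine this.trans (le_of_eq ?_)
  ring

lemma noSol (A B D E : Fin 5 → ℤ)
    (h1 : 2 * dot5 A A + 30 * dot5 B B
      + 3 * (dot5 D D + 4 * dot5 D E + 4 * dot5 E E) + 5 * dot5 D D = 44)
    (h6 : (dot5 A D + 2 * dot5 A E) + 5 * dot5 B D = 5)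
    (h10 : dot5 A D + 3 * (dot5 B D + 2 * dot5 B E) = 1)
    (h15 : 2 * dot5 A B + (dot5 D D + 2 * dot5 D E) = 2) : False := by
  have nA := dot5_nn A
  have nB := dot5_nn B
  have nD := dot5_nn D
  have nE := dot5_nn E
  have nC := dot5_nn (fun i => 1 * D i + 2 * E i)
  rw [dot5_comb, dot5_comm E D] at nC
  have hB : dot5 B B = 0 ∨ dot5 B B = 1 := by omega
  rcases hB with hB | hB
  · have z1 := dot5_zero D hB
    have z2 := dot5_zero E hB
    have z3 := dot5_zero A hB
    rw [dot5_comm B A] at z3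
    have hAD : dot5 A D = 1 := by omega
    have hAE : dot5 A E = 2 := by omega
    have hE0 : dot5 E E ≠ 0 := by
      intro h
      have := dot5_zero A h
      rw [dot5_comm] at this; omega
    have hD0 : dot5 D D ≠ 0 := by
      intro h
      have := dot5_zero A h
      rw [dot5_comm] at this; omega
    have hS : dot5 A A + dot5 D D + 6 * dot5 E E = 16 := by omega
    have hE : dot5 E E = 1 ∨ dot5 E E = 2 := by omega
    have cs1 := dot5_cs A E
    have cs2 := dot5_cs A D
    rcases hE with hE | hE
    · have hD : dot5 D D = 2 ∨ dot5 D D = 4 ∨ dot5 D D = 6 ∨ dot5 D D = 8 ∨ dot5 D D = 10 := by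
        omega
      rcases hD with hD | hD | hD | hD | hD
      · have hA : dot5 A A = 8 := by omega
        have hDE : dot5 D E = 0 := by omega
        have c1 := dot5_comb 1 (-2) 1 (-2) A E A E
        have c2 := dot5_comb 1 (-2) 1 0 A E E E
        have c3 := dot5_comb 1 (-2) 1 0 A E D D
        have e1 := dot5_comm E A
        have e2 := dot5_comm E D
        simp only [one_mul, zero_mul, add_zero] at c1 c2 c3
        exact unit5 (fun i => E i) (fun i => A i + -2 * E i) (fun i => D i) hE
          (by rw [c2]; omega) hDE (by rw [c1]; omega) hD (by rw [c3]; omega)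
      · have hA : dot5 A A = 6 := by omega
        have hDE : dot5 D E = -1 := by omega
        have c := dot5_csc 1 1 1 A E D E (-2)
        rw [hA, hAE, hE, hD, hDE, hAD, dot5_comm E D, hDE] at c
        norm_num at c
      · have hA : dot5 A A = 4 := by omega
        have hDE : dot5 D E = -2 := by omega
        have c := dot5_csc 1 1 0 A E D E (-2)
        rw [hA, hAE, hE, hD, hDE, hAD, dot5_comm E D, hDE] at c
        norm_num at c
      · have hA : dot5 A A = 2 := by omega
        rw [hA, hAE, hE] at cs1
        norm_num at cs1
      · have hA : dot5 A A = 0 := by omega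
        rw [hA, hAE, hE] at cs1
        norm_num at cs1
    · have hD : dot5 D D = 2 ∨ dot5 D D = 4 := by omega
      rcases hD with hD | hD
      · have hA : dot5 A A = 2 := by omega
        have hDE : dot5 D E = 0 := by omega
        have c := dot5_csc 1 1 0 A E D E (-1)
        rw [hA, hAE, hE, hD, hDE, hAD, dot5_comm E D, hDE] at c
        norm_num at c
      · have hA : dot5 A A = 0 := by omega
        rw [hA, hAE, hE] at cs1
        norm_num at cs1
  · have hD : dot5 D D = 0 ∨ dot5 D D = 2 := by omega
    rcases hD with hD | hD
    · have z1 := dot5_zero A hD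
      have z2 := dot5_zero B hD
      rw [dot5_comm] at z1 z2
      omega
    · omega


lemma m66 : (Real.sqrt 6) * (Real.sqrt 6) = 6 := Real.mul_self_sqrt (by norm_num)
lemma m1010 : (Real.sqrt 10) * (Real.sqrt 10) = 10 := Real.mul_self_sqrt (by norm_num)
lemma m1515 : (Real.sqrt 15) * (Real.sqrt 15) = 15 := Real.mul_self_sqrt (by norm_num)
lemma m610 : (Real.sqrt 6) * (Real.sqrt 10) = 2 * (Real.sqrt 15) := by
  rw [← Real.sqrt_mul (by norm_num)]
  rw [show (6:ℝ) * 10 = 2^2 * 15 by norm_num, Real.sqrt_mul (by norm_num),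
    Real.sqrt_sq (by norm_num)]
lemma m615 : (Real.sqrt 6) * (Real.sqrt 15) = 3 * (Real.sqrt 10) := by
  rw [← Real.sqrt_mul (by norm_num)]
  rw [show (6:ℝ) * 15 = 3^2 * 10 by norm_num, Real.sqrt_mul (by norm_num),
    Real.sqrt_sq (by norm_num)]
lemma m1015 : (Real.sqrt 10) * (Real.sqrt 15) = 5 * (Real.sqrt 6) := by
  rw [← Real.sqrt_mul (by norm_num)]
  rw [show (10:ℝ) * 15 = 5^2 * 6 by norm_num, Real.sqrt_mul (by norm_num),
    Real.sqrt_sq (by norm_num)]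

/-- The conjugates of an element of the field. -/
def conjForm (p q r s : ℚ) (e f : ℝ) : ℝ :=
  p + q * (e * (Real.sqrt 6)) + r * (f * (Real.sqrt 10)) + s * (e * f * (Real.sqrt 15))

lemma conjForm_mul (p q r s p' q' r' s' : ℚ) (e f : ℝ) (he : e * e = 1) (hf : f * f = 1) :
    conjForm p q r s e f * conjForm p' q' r' s' e f =
      conjForm (p*p' + 6*q*q' + 10*r*r' + 15*s*s') (p*q' + q*p' + 5*r*s' + 5*s*r')
        (p*r' + r*p' + 3*q*s' + 3*s*q') (p*s' + s*p' + 2*q*r' + 2*r*q') e f := by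
  have h1 := m66
  have h2 := m1010
  have h3 := m1515
  have h4 := m610
  have h5 := m615
  have h6 := m1015
  unfold conjForm
  push_cast
  linear_combination ((q:ℝ)*q'*(Real.sqrt 6)*(Real.sqrt 6) + s*s'*f*f*(Real.sqrt 15)*(Real.sqrt 15) + (q*s'+s*q')*f*(Real.sqrt 6)*(Real.sqrt 15)) * he
    + ((r:ℝ)*r'*(Real.sqrt 10)*(Real.sqrt 10) + s*s'*(Real.sqrt 15)*(Real.sqrt 15) + (r*s'+s*r')*e*(Real.sqrt 10)*(Real.sqrt 15)) * hf
    + (q:ℝ)*q' * h1 + (r:ℝ)*r' * h2 + (s:ℝ)*s' * h3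
    + ((q:ℝ)*r'+r*q')*e*f * h4 + ((q:ℝ)*s'+s*q')*f * h5 + ((r:ℝ)*s'+s*r')*e * h6

lemma lin2 (d : ℝ) (hd : Irrational d) (a b : ℚ) (h : (a:ℝ) + b * d = 0) : a = 0 ∧ b = 0 := by
  have hb : b = 0 := by
    by_contra hb
    apply hd
    refine ⟨-a / b, ?_⟩
    have : (b:ℝ) ≠ 0 := by exact_mod_cast hb
    push_cast
    field_simp
    linarith
  subst hb
  simp at h
  exact ⟨h, rfl⟩

lemma ir6 : Irrational (Real.sqrt 6) := by
  rw [irrational_sqrt_ofNat_iff]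
  rintro ⟨n, hn⟩
  have : n < 3 := by nlinarith
  interval_cases n <;> omega
lemma ir10 : Irrational (Real.sqrt 10) := by
  rw [irrational_sqrt_ofNat_iff]
  rintro ⟨n, hn⟩
  have : n < 4 := by nlinarith
  interval_cases n <;> omega
lemma ir15 : Irrational (Real.sqrt 15) := by
  rw [irrational_sqrt_ofNat_iff]
  rintro ⟨n, hn⟩
  have : n < 4 := by nlinarith
  interval_cases n <;> omega

lemma lin3 (u v n : ℚ) (h : (u:ℝ) + v * (Real.sqrt 6) + n * (Real.sqrt 10) = 0) : n = 0 := by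
  have h2 : ((u^2 + 6*v^2 - 10*n^2 : ℚ):ℝ) + (2*u*v : ℚ) * (Real.sqrt 6) = 0 := by
    push_cast
    linear_combination (u + v*(Real.sqrt 6) - n*(Real.sqrt 10)) * h - v^2 * m66 + n^2 * m1010
  have h3 := (lin2 _ ir6 _ _ h2).2
  rcases mul_eq_zero.mp h3 with h4 | h4
  · have h4 : u = 0 := by linarith
    subst h4
    have : ((6*v:ℚ):ℝ) + (2*n : ℚ) * (Real.sqrt 15) = 0 := by
      push_cast at *
      linear_combination (Real.sqrt 6) * h - v * m66 - n * m610
    have := (lin2 _ ir15 _ _ this).2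
    linarith
  · subst h4
    have : (u:ℝ) + n * (Real.sqrt 10) = 0 := by
      push_cast at *
      linarith
    exact (lin2 _ ir10 _ _ this).2

lemma lin4 (p q r s : ℚ) (h : (p:ℝ) + q * (Real.sqrt 6) + r * (Real.sqrt 10) + s * (Real.sqrt 15) = 0) :
    p = 0 ∧ q = 0 ∧ r = 0 ∧ s = 0 := by
  have hN : r^2 - 3/2*s^2 = 0 := by
    apply lin3 (p*r - 3*q*s) (q*r - p*s/2)
    push_cast
    linear_combination (r - s/2*(Real.sqrt 6)) * h + q*s/2 * m66 + r*s/2*m610 + s^2/2*m615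
  have hrs : (r:ℝ) + (s/2 : ℚ) * (Real.sqrt 6) = 0 ∨ (r:ℝ) + (-s/2 : ℚ) * (Real.sqrt 6) = 0 := by
    rw [← mul_eq_zero]
    have : ((r^2 - 3/2*s^2 : ℚ):ℝ) = 0 := by rw [hN]; simp
    push_cast at *
    linear_combination this - s^2/4 * m66
  have hrs' : r = 0 ∧ s = 0 := by
    rcases hrs with h | h
    · have := lin2 _ ir6 _ _ h
      exact ⟨this.1, by linarith [this.2]⟩
    · have := lin2 _ ir6 _ _ h
      exact ⟨this.1, by linarith [this.2]⟩
  obtain ⟨rfl, rfl⟩ := hrs'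
  have := lin2 _ ir6 p q (by push_cast at h; linarith)
  exact ⟨this.1, this.2, rfl, rfl⟩

lemma mem_field {x : ℝ} (hx : x ∈ biquadField 6 10) :
    ∃ p q r s : ℚ, x = conjForm p q r s 1 1 := by
  have halg : ∀ x ∈ ({(Real.sqrt 6), (Real.sqrt 10)} : Set ℝ), IsAlgebraic ℚ x := by
    intro x hx
    have : IsIntegral ℚ (x^2) := by
      rcases hx with rfl | rfl
      · rw [pow_two, m66]; exact_mod_cast isIntegral_algebraMap (R := ℚ) (A := ℝ) (x := 6)
      · rw [pow_two, m1010]; exact_mod_cast isIntegral_algebraMap (R := ℚ) (A := ℝ) (x := 10)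
    exact (IsIntegral.of_pow (by norm_num) this).isAlgebraic
  have hx2 : x ∈ Algebra.adjoin ℚ ({(Real.sqrt 6), (Real.sqrt 10)} : Set ℝ) := by
    rw [← IntermediateField.adjoin_toSubalgebra_of_isAlgebraic halg]
    exact hx
  induction hx2 using Algebra.adjoin_induction with
  | mem y hy =>
    rcases hy with rfl | rfl
    · exact ⟨0, 1, 0, 0, by simp [conjForm]⟩
    · exact ⟨0, 0, 1, 0, by simp [conjForm]⟩
  | algebraMap t => exact ⟨t, 0, 0, 0, by simp [conjForm]⟩
  | add y z hy hz h1 h2 =>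
    have mem : ∀ w ∈ Algebra.adjoin ℚ ({(Real.sqrt 6), (Real.sqrt 10)} : Set ℝ), w ∈ biquadField 6 10 := by
      intro w hw
      exact IntermediateField.algebra_adjoin_le_adjoin _ _ hw
    obtain ⟨p, q, r, s, h1⟩ := h1 (mem _ hy)
    obtain ⟨p', q', r', s', h2⟩ := h2 (mem _ hz)
    exact ⟨p+p', q+q', r+r', s+s', by rw [h1, h2]; simp only [conjForm]; push_cast; ring⟩
  | mul y z hy hz h1 h2 =>
    have mem : ∀ w ∈ Algebra.adjoin ℚ ({(Real.sqrt 6), (Real.sqrt 10)} : Set ℝ), w ∈ biquadField 6 10 := by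
      intro w hw
      exact IntermediateField.algebra_adjoin_le_adjoin _ _ hw
    obtain ⟨p, q, r, s, h1⟩ := h1 (mem _ hy)
    obtain ⟨p', q', r', s', h2⟩ := h2 (mem _ hz)
    exact ⟨_, _, _, _, by rw [h1, h2]; exact conjForm_mul _ _ _ _ _ _ _ _ _ _ (by simp) (by simp)⟩

lemma conj_poly (p q r s : ℚ) (P : Polynomial ℤ) : ∃ p' q' r' s' : ℚ, ∀ e f : ℝ, e*e = 1 → f*f = 1 →
    Polynomial.aeval (conjForm p q r s e f) P = conjForm p' q' r' s' e f := by
  induction P using Polynomial.induction_on with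
  | C a => exact ⟨a, 0, 0, 0, fun e f _ _ => by simp [conjForm]⟩
  | add P Q h1 h2 =>
    obtain ⟨p1, q1, r1, s1, h1⟩ := h1
    obtain ⟨p', q', r', s', h2⟩ := h2
    refine ⟨p1+p', q1+q', r1+r', s1+s', fun e f he hf => ?_⟩
    rw [map_add, h1 e f he hf, h2 e f he hf]
    simp only [conjForm]; push_cast; ring
  | monomial n a h1 =>
    obtain ⟨p1, q1, r1, s1, h1⟩ := h1
    refine ⟨p1*p + 6*q1*q + 10*r1*r + 15*s1*s, p1*q + q1*p + 5*r1*s + 5*s1*r,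
      p1*r + r1*p + 3*q1*s + 3*s1*q, p1*s + s1*p + 2*q1*r + 2*r1*q, fun e f he hf => ?_⟩
    rw [pow_succ, ← mul_assoc, map_mul, h1 e f he hf, Polynomial.aeval_X]
    exact conjForm_mul _ _ _ _ _ _ _ _ _ _ he hf

lemma conj_int (p q r s : ℚ) (h : IsIntegral ℤ (conjForm p q r s 1 1)) (e f : ℝ)
    (he : e*e = 1) (hf : f*f = 1) : IsIntegral ℤ (conjForm p q r s e f) := by
  obtain ⟨P, hP, h0⟩ := h
  refine ⟨P, hP, ?_⟩
  obtain ⟨p', q', r', s', H⟩ := conj_poly p q r s P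
  rw [← Polynomial.aeval_def] at *
  rw [H 1 1 (by simp) (by simp)] at h0
  obtain ⟨rfl, rfl, rfl, rfl⟩ := lin4 p' q' r' s' (by simpa [conjForm] using h0)
  rw [H e f he hf]
  simp [conjForm]

lemma int_of_eq {x y : ℝ} (h : IsIntegral ℤ y) (e : x = y) : IsIntegral ℤ x := e ▸ h

lemma rat_int (t : ℚ) (h : IsIntegral ℤ (t:ℝ)) : ∃ n : ℤ, t = n := by
  have h2 : IsIntegral ℤ t := by
    have : IsIntegral ℤ (algebraMap ℚ ℝ t) := by simpa using h
    exact (isIntegral_algebraMap_iff (algebraMap ℚ ℝ).injective).mp this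
  obtain ⟨n, hn⟩ := IsIntegrallyClosed.isIntegral_iff.mp h2
  exact ⟨n, by rw [← hn]; simp⟩

lemma quad_int (d : ℤ) (hsq : Squarefree d) (hd : d % 4 = 2 ∨ d % 4 = 3) (w : ℝ) (hw : w * w = d)
    (u v : ℚ) (h1 : IsIntegral ℤ ((u:ℝ) + v * w)) (h2 : IsIntegral ℤ ((u:ℝ) - v * w)) :
    (∃ n : ℤ, u = n) ∧ ∃ n : ℤ, v = n := by
  obtain ⟨m, hm⟩ := rat_int (2*u) (by
    have := h1.add h2
    refine int_of_eq this ?_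
    push_cast; ring)
  obtain ⟨n, hn⟩ := rat_int (u^2 - d*v^2) (by
    have := h1.mul h2
    refine int_of_eq this ?_
    push_cast
    linear_combination v^2 * hw)
  have hd0 : d ≠ 0 := by rintro rfl; omega
  obtain ⟨k, hk⟩ := rat_int (d*(2*v)) (by
    apply IsIntegral.of_pow (n := 2) (by norm_num)
    have : (((d*(2*v):ℚ):ℝ))^2 = ((d*(m^2-4*n) : ℤ):ℝ) := by
      have : ((d*(2*v):ℚ))^2 = ((d*(m^2-4*n) : ℤ):ℚ) := by
        push_cast
        rw [← hm, ← hn]; ring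
      exact_mod_cast congrArg (fun z : ℚ => (z:ℝ)) this
    rw [this]
    exact isIntegral_algebraMap (R := ℤ) (A := ℝ) (x := (d*(m^2-4*n) : ℤ)))
  have hk2 : k^2 = d*(m^2-4*n) := by
    have : (k:ℚ)^2 = d*(m^2-4*n) := by
      rw [← hk, ← hm, ← hn]; ring
    exact_mod_cast this
  obtain ⟨l, rfl⟩ : d ∣ k := (hsq.dvd_pow_iff_dvd (n := 2) (by norm_num)).mp ⟨_, hk2⟩
  have hl : 2*v = l := by
    have hd0' : (d:ℚ) ≠ 0 := by exact_mod_cast hd0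
    push_cast at hk
    exact mul_left_cancel₀ hd0' hk
  have hl2 : d * l^2 = m^2 - 4*n := by
    apply mul_left_cancel₀ hd0
    rw [← hk2]; ring
  have ev : (∃ m', m = 2*m') ∧ ∃ l', l = 2*l' := by
    obtain ⟨d', hd'⟩ : ∃ d', d = 4*d'+2 ∨ d = 4*d'+3 := ⟨d/4, by omega⟩
    obtain ⟨m', hm' | hm'⟩ := Int.even_or_odd' m <;> obtain ⟨l', hl' | hl'⟩ := Int.even_or_odd' l
    · exact ⟨⟨_, hm'⟩, _, hl'⟩
    all_goals
      exfalso
      rw [hm', hl'] at hl2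
      ring_nf at hl2
      rcases hd' with rfl | rfl <;> ring_nf at hl2 <;> omega
  obtain ⟨⟨m', rfl⟩, l', rfl⟩ := ev
  push_cast at hm hl
  exact ⟨⟨m', by linarith⟩, l', by linarith⟩

lemma sqf_small (n : ℕ) (h0 : 0 < n) (h : n < 16) (h4 : ¬ 4 ∣ n) (h9 : ¬ 9 ∣ n) :
    Squarefree n := by
  intro x hx
  have hle := Nat.le_of_dvd h0 hx
  have hx4 : x < 4 := by nlinarith
  interval_cases x
  · simp at hx; omega
  · simp
  · exact absurd hx h4
  · exact absurd hx h9

lemma int_form {x : ℝ} (hx : x ∈ ringOfInt 6 10) : ∃ a b d e : ℤ,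
    x = a + b * (Real.sqrt 15) + ((d + 2 * e) * (Real.sqrt 6) + d * (Real.sqrt 10)) / 2 := by
  obtain ⟨hK, hI⟩ := hx
  obtain ⟨p, q, r, s, rfl⟩ := mem_field hK
  have C := conj_int p q r s hI
  have c1 := C 1 1 (by norm_num) (by norm_num)
  have c2 := C 1 (-1) (by norm_num) (by norm_num)
  have c3 := C (-1) 1 (by norm_num) (by norm_num)
  have c4 := C (-1) (-1) (by norm_num) (by norm_num)
  have sf6 : Squarefree (6:ℤ) := by
    rw [← Int.squarefree_natAbs]; exact sqf_small 6 (by norm_num) (by norm_num) (by norm_num) (by norm_num)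
  have sf10 : Squarefree (10:ℤ) := by
    rw [← Int.squarefree_natAbs]; exact sqf_small 10 (by norm_num) (by norm_num) (by norm_num) (by norm_num)
  have sf15 : Squarefree (15:ℤ) := by
    rw [← Int.squarefree_natAbs]; exact sqf_small 15 (by norm_num) (by norm_num) (by norm_num) (by norm_num)
  obtain ⟨⟨P, hP⟩, Q, hQ⟩ := quad_int 6 sf6 (by norm_num) (Real.sqrt 6) (by simp) (2*p) (2*q)
    (by refine int_of_eq (c1.add c2) ?_; simp only [conjForm]; push_cast; ring)
    (by refine int_of_eq (c3.add c4) ?_; simp only [conjForm]; push_cast; ring)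
  obtain ⟨-, R, hR⟩ := quad_int 10 sf10 (by norm_num) (Real.sqrt 10) (by simp) (2*p) (2*r)
    (by refine int_of_eq (c1.add c3) ?_; simp only [conjForm]; push_cast; ring)
    (by refine int_of_eq (c2.add c4) ?_; simp only [conjForm]; push_cast; ring)
  obtain ⟨-, S, hS⟩ := quad_int 15 sf15 (by norm_num) (Real.sqrt 15) (by simp) (2*p) (2*s)
    (by refine int_of_eq (c1.add c4) ?_; simp only [conjForm]; push_cast; ring)
    (by refine int_of_eq (c2.add c3) ?_; simp only [conjForm]; push_cast; ring)
  obtain ⟨⟨U, hU⟩, V, hV⟩ := quad_int 6 sf6 (by norm_num) (Real.sqrt 6) (by simp)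
    (p^2+6*q^2-10*r^2-15*s^2) (2*p*q-10*r*s)
    (by
      refine int_of_eq (c1.mul c2) ?_; simp only [conjForm]; push_cast
      linear_combination -q^2*m66 + r^2*m1010 + s^2*m1515 + 2*r*s*m1015)
    (by
      refine int_of_eq (c3.mul c4) ?_; simp only [conjForm]; push_cast
      linear_combination -q^2*m66 + r^2*m1010 + s^2*m1515 - 2*r*s*m1015)
  have hU' : P^2+6*Q^2-10*R^2-15*S^2 = 4*U := by
    have : (P:ℚ)^2+6*Q^2-10*R^2-15*S^2 = 4*U := by
      rw [← hP, ← hQ, ← hR, ← hS, ← hU]; ring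
    exact_mod_cast this
  have hV' : P*Q-5*(R*S) = 2*V := by
    have : (P:ℚ)*Q-5*(R*S) = 2*V := by
      rw [← hP, ← hQ, ← hR, ← hS, ← hV]; ring
    exact_mod_cast this
  have key : (∃ a, P = 2*a) ∧ (∃ b, S = 2*b) ∧ ∃ e, Q = R + 2*e := by
    obtain ⟨a, ha | ha⟩ := Int.even_or_odd' P <;> obtain ⟨b, hb | hb⟩ := Int.even_or_odd' S <;>
    obtain ⟨c, hc | hc⟩ := Int.even_or_odd' Q <;> obtain ⟨g, hg | hg⟩ := Int.even_or_odd' R <;>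
    first
    | exact ⟨⟨a, ha⟩, ⟨b, hb⟩, c - g, by omega⟩
    | (exfalso
       rw [ha, hb, hc, hg] at hU' hV'
       ring_nf at hU' hV'
       omega)
  obtain ⟨⟨a, rfl⟩, ⟨b, rfl⟩, e, rfl⟩ := key
  refine ⟨a, b, R, e, ?_⟩
  push_cast at *
  have hp : p = a := by linarith
  have hs : s = b := by linarith
  have hq : q = (R + 2*e)/2 := by linarith
  have hr : r = R/2 := by linarith
  rw [hp, hs, hq, hr]
  simp only [conjForm]
  push_cast
  ring

lemma alg_int6 : IsIntegral ℤ (Real.sqrt 6) := by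
  apply IsIntegral.of_pow (n := 2) (by norm_num)
  rw [pow_two, m66]
  exact_mod_cast isIntegral_algebraMap (R := ℤ) (A := ℝ) (x := 6)

lemma mem6 : (Real.sqrt 6) ∈ ringOfInt 6 10 :=
  ⟨IntermediateField.subset_adjoin _ _ (by simp), alg_int6⟩

lemma mem_half : ((Real.sqrt 6) + (Real.sqrt 10)) / 2 ∈ ringOfInt 6 10 := by
  refine ⟨?_, ?_⟩
  · have h6 : (Real.sqrt 6) ∈ biquadField 6 10 := IntermediateField.subset_adjoin _ _ (by simp)
    have h10 : (Real.sqrt 10) ∈ biquadField 6 10 := IntermediateField.subset_adjoin _ _ (by simp)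
    exact div_mem (add_mem h6 h10) (ofNat_mem _ 2)
  · apply IsIntegral.of_pow (n := 2) (by norm_num)
    have : (((Real.sqrt 6) + (Real.sqrt 10)) / 2)^2 = 4 + (Real.sqrt 15) := by
      linear_combination m66/4 + m1010/4 + m610/2
    rw [this]
    refine IsIntegral.add ?_ ?_
    · exact_mod_cast isIntegral_algebraMap (R := ℤ) (A := ℝ) (x := 4)
    · apply IsIntegral.of_pow (n := 2) (by norm_num)
      rw [pow_two, m1515]
      exact_mod_cast isIntegral_algebraMap (R := ℤ) (A := ℝ) (x := 15)

lemma mem_nat (n : ℕ) : (n:ℝ) ∈ ringOfInt 6 10 :=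
  ⟨natCast_mem _ n, by exact_mod_cast isIntegral_algebraMap (R := ℤ) (A := ℝ) (x := n)⟩

lemma mem_add {x y : ℝ} (hx : x ∈ ringOfInt 6 10) (hy : y ∈ ringOfInt 6 10) :
    x + y ∈ ringOfInt 6 10 := ⟨add_mem hx.1 hy.1, hx.2.add hy.2⟩

lemma pad {n : ℕ} {α : ℝ} (h : SumOfSquaresLen (ringOfInt 6 10) n α) :
    SumOfSquaresLen (ringOfInt 6 10) (n+1) α := by
  obtain ⟨x, hx, hs⟩ := h
  refine ⟨Fin.cons 0 x, ?_, ?_⟩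
  · intro i
    refine Fin.cases ?_ ?_ i
    · simpa using mem_nat 0
    · intro j; simpa using hx j
  · rw [Fin.sum_univ_succ]; simpa using hs

lemma pad_le {n m : ℕ} (hnm : n ≤ m) {α : ℝ} (h : SumOfSquaresLen (ringOfInt 6 10) n α) :
    SumOfSquaresLen (ringOfInt 6 10) m α := by
  induction hnm with
  | refl => exact h
  | step _ ih => exact pad ih

lemma not_five : ¬ SumOfSquaresLen (ringOfInt 6 10) 5
    ((1 : ℝ) ^ 2 + 1 ^ 2 + 1 ^ 2 + (2 + Real.sqrt 6) ^ 2
          + ((Real.sqrt 6 + Real.sqrt 10) / 2) ^ 2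
          + (1 + (Real.sqrt 6 + Real.sqrt 10) / 2) ^ 2) := by
  rintro ⟨x, hx, hs⟩
  choose A B D E hE using fun i => int_form (hx i)
  have hsq : ∀ i, x i ^ 2 =
      (((2 * (A i * A i) + 30 * (B i * B i) +
        3 * (D i * D i + 4 * (D i * E i) + 4 * (E i * E i)) + 5 * (D i * D i) : ℤ) : ℝ) / 2)
      + ((A i * D i + 2 * (A i * E i) + 5 * (B i * D i) : ℤ) : ℝ) * (Real.sqrt 6)
      + ((A i * D i + 3 * (B i * D i + 2 * (B i * E i)) : ℤ) : ℝ) * (Real.sqrt 10)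
      + ((2 * (A i * B i) + (D i * D i + 2 * (D i * E i)) : ℤ) : ℝ) * (Real.sqrt 15) := by
    intro i
    rw [hE i]
    push_cast
    linear_combination (B i:ℝ)^2 * m1515 + ((D i:ℝ)+2*E i)^2/4 * m66 + (D i:ℝ)^2/4*m1010
      + (D i:ℝ)*(D i + 2*E i)/2*m610 + (B i:ℝ)*(D i + 2*E i)*m615 + (B i:ℝ)*D i*m1015
  simp only [hsq, Fin.sum_univ_five] at hs
  have L := lin4
    (((2 * dot5 A A + 30 * dot5 B B
      + 3 * (dot5 D D + 4 * dot5 D E + 4 * dot5 E E) + 5 * dot5 D D : ℤ) : ℚ) / 2 - 22)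
    (((dot5 A D + 2 * dot5 A E) + 5 * dot5 B D - 5 : ℤ) : ℚ)
    ((dot5 A D + 3 * (dot5 B D + 2 * dot5 B E) - 1 : ℤ) : ℚ)
    ((2 * dot5 A B + (dot5 D D + 2 * dot5 D E) - 2 : ℤ) : ℚ)
    (by
      simp only [dot5, Fin.sum_univ_five]
      push_cast at *
      linear_combination -hs + 3/2*m66 + m1010/2 + m610)
  obtain ⟨l1, l2, l3, l4⟩ := L
  have l1' : ((2 * dot5 A A + 30 * dot5 B B
      + 3 * (dot5 D D + 4 * dot5 D E + 4 * dot5 E E) + 5 * dot5 D D : ℤ) : ℚ) = (44 : ℤ) := by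
    push_cast at *; linarith
  have l1'' := Int.cast_injective l1'
  have l2' := Int.cast_eq_zero.mp l2
  have l3' := Int.cast_eq_zero.mp l3
  have l4' := Int.cast_eq_zero.mp l4
  exact noSol A B D E l1'' (by linarith) (by linarith) (by linarith)

theorem k6_10_length_six :
    sqLength (ringOfInt 6 10)
        ((1 : ℝ) ^ 2 + 1 ^ 2 + 1 ^ 2 + (2 + Real.sqrt 6) ^ 2
          + ((Real.sqrt 6 + Real.sqrt 10) / 2) ^ 2
          + (1 + (Real.sqrt 6 + Real.sqrt 10) / 2) ^ 2) = 6 := by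
  apply le_antisymm
  · apply sInf_le
    refine ⟨6, by norm_num, ![1, 1, 1, 2 + Real.sqrt 6, (Real.sqrt 6 + Real.sqrt 10) / 2,
      1 + (Real.sqrt 6 + Real.sqrt 10) / 2], ?_, ?_⟩
    · have h1 : (1:ℝ) ∈ ringOfInt 6 10 := by simpa using mem_nat 1
      have h2 : (2:ℝ) ∈ ringOfInt 6 10 := by simpa using mem_nat 2
      intro i
      fin_cases i
      · exact h1
      · exact h1
      · exact h1
      · exact mem_add h2 mem6
      · exact mem_half
      · exact mem_add h1 mem_half
    · simp [Fin.sum_univ_succ]; ring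
  · apply le_sInf
    rintro n ⟨k, rfl, hk⟩
    by_contra hlt
    push Not at hlt
    have hk6 : k < 6 := by exact_mod_cast hlt
    exact not_five (pad_le (by omega) hk)
end
end

section
/- Let s ≡ 2 (mod 4) be square-free with s ≥ 118, 3 ∤ (s/2) being false allowed but gcd(6,s) = 2, and K = Q(√6, √s). Then α = 1² + 1² + 1² + (1+√6)² + ((√6+√s)/2)² + (1+(√6+√s)/2)² has length exactly 6 in O_K; in particular P(O_K) ≥ 6. -/
open scoped Classical

noncomputable section

/-- Conjugates of `a + b√6 + c√s + d√t`, where `p = √6`, `q = √s`, `w = √t`. -/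
def conjRep (p q w e f : ℝ) (a b c d : ℚ) : ℝ := a + e * b * p + f * c * q + e * f * d * w

lemma not_rat_of_sq {m : ℕ} (hm : Squarefree m) (h1 : m ≠ 1) {p : ℝ} (hp : p ^ 2 = m) (r : ℚ) :
    (r : ℝ) ≠ p := by
  intro h
  have h2 : r ^ 2 = (m : ℚ) := by
    have : ((r ^ 2 : ℚ) : ℝ) = ((m : ℚ) : ℝ) := by push_cast; rw [h, hp]
    exact_mod_cast this
  have h3 : IsSquare (m : ℚ) := ⟨r, by rw [← h2]; ring⟩
  rw [Rat.isSquare_natCast_iff] at h3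
  obtain ⟨k, hk⟩ := h3
  have := hm k ⟨1, by rw [hk]; ring⟩
  rw [Nat.isUnit_iff] at this
  subst this
  omega

lemma int_of_sq {m : ℕ} (hm : Squarefree m) (q : ℚ) (k : ℤ) (h : (m : ℚ) * q ^ 2 = k) :
    ∃ V : ℤ, q = V := by
  have hd : (q.den : ℚ) ≠ 0 := by exact_mod_cast q.den_nz
  have h1 : (m : ℤ) * q.num ^ 2 = k * (q.den : ℤ) ^ 2 := by
    have h2 : (m : ℚ) * (q.num : ℚ) ^ 2 = k * (q.den : ℚ) ^ 2 := by
      rw [← h]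
      have := Rat.num_div_den q
      have h3 : q * q.den = q.num := Rat.mul_den_eq_num q
      rw [← h3]; ring
    exact_mod_cast h2
  have h2 : (q.den : ℤ) ^ 2 ∣ (m : ℤ) * q.num ^ 2 := ⟨k, by rw [h1]; ring⟩
  have hc : IsCoprime ((q.den : ℤ) ^ 2) (q.num ^ 2) := by
    apply IsCoprime.pow
    rw [Int.isCoprime_iff_gcd_eq_one, Int.gcd_comm]
    simpa [Int.gcd] using q.reduced
  have h3 := hc.dvd_of_dvd_mul_right h2
  have h4 : q.den ^ 2 ∣ m := by exact_mod_cast h3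
  have h5 := hm q.den (by rwa [← sq])
  rw [Nat.isUnit_iff] at h5
  exact ⟨q.num, by rw [← Rat.mul_den_eq_num q, h5]; simp⟩

lemma isInt_congr {x y : ℝ} (h : IsIntegral ℤ x) (e : y = x) : IsIntegral ℤ y := e ▸ h

lemma int_of_isIntegral {r : ℚ} (h : IsIntegral ℤ (r : ℝ)) : ∃ k : ℤ, r = k := by
  have h1 : IsIntegral ℤ r := by
    have : (r : ℝ) = algebraMap ℚ ℝ r := by simp
    rw [this] at h
    exact (isIntegral_algebraMap_iff (algebraMap ℚ ℝ).injective).1 h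
  obtain ⟨k, hk⟩ := IsIntegrallyClosed.isIntegral_iff.1 h1
  exact ⟨k, by rw [← hk]; simp⟩

lemma quad_int_s14 {m : ℕ} (hm : Squarefree m) {p : ℝ} (hp : p ^ 2 = m) (u v : ℚ)
    (h1 : IsIntegral ℤ ((u : ℝ) + v * p)) (h2 : IsIntegral ℤ ((u : ℝ) - v * p)) :
    ∃ U V : ℤ, 2 * u = U ∧ 2 * v = V ∧ (4 : ℤ) ∣ U ^ 2 - m * V ^ 2 := by
  obtain ⟨U, hU⟩ := int_of_isIntegral (r := 2 * u) (by
    refine isInt_congr (h1.add h2) ?_; push_cast; ring)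
  obtain ⟨n, hn⟩ := int_of_isIntegral (r := u ^ 2 - m * v ^ 2) (by
    refine isInt_congr (h1.mul h2) ?_; push_cast; rw [← hp]; ring)
  obtain ⟨V, hV⟩ := int_of_sq hm (2 * v) (U ^ 2 - 4 * n) (by
    push_cast; rw [← hU, ← hn]; ring)
  refine ⟨U, V, hU, hV, n, ?_⟩
  have : ((U : ℚ) ^ 2 - m * V ^ 2) = 4 * n := by rw [← hU, ← hV, ← hn]; ring
  exact_mod_cast this

lemma quad_int' {m : ℕ} (hm : Squarefree m) (hm4 : m % 4 = 2) {p : ℝ} (hp : p ^ 2 = m) (u v : ℚ)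
    (h1 : IsIntegral ℤ ((u : ℝ) + v * p)) (h2 : IsIntegral ℤ ((u : ℝ) - v * p)) :
    ∃ U V : ℤ, u = U ∧ v = V := by
  obtain ⟨U, V, hU, hV, hd⟩ := quad_int_s14 hm hp u v h1 h2
  obtain ⟨j, hj⟩ : ∃ j : ℤ, (m : ℤ) = 4 * j + 2 := ⟨m / 4, by omega⟩
  rw [hj] at hd
  obtain ⟨n, hn⟩ := hd
  have hUe : Even U := by
    by_contra hc
    rw [Int.not_even_iff_odd] at hc
    obtain ⟨x, rfl⟩ := hc
    have : 2 * (2 * n + (2 * j + 1) * V ^ 2 - 2 * x ^ 2 - 2 * x) = 1 := by linarith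
    omega
  obtain ⟨x, rfl⟩ := hUe
  have hVe : Even V := by
    by_contra hc
    rw [Int.not_even_iff_odd] at hc
    obtain ⟨y, rfl⟩ := hc
    have : 2 * (x ^ 2 - n - j * (2 * y + 1) ^ 2 - 2 * y ^ 2 - 2 * y) = 1 := by linarith
    omega
  obtain ⟨y, rfl⟩ := hVe
  push_cast at hU hV
  exact ⟨x, y, by linarith, by linarith⟩

section setup
variable {z : ℕ} {p q w : ℝ}

lemma indep (hz : Squarefree (2 * z)) (ht : Squarefree (3 * z))
    (hp : p ^ 2 = 6) (hq : q ^ 2 = 2 * z) (hw : w ^ 2 = 3 * z) (hpq : p * q = 2 * w)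
    (a b c d : ℚ) (h : (a : ℝ) + b * p + c * q + d * w = 0) : a = 0 ∧ b = 0 ∧ c = 0 ∧ d = 0 := by
  have np : ∀ r : ℚ, (r : ℝ) ≠ p :=
    not_rat_of_sq (m := 6) (by
      rw [show 6 = 2 * 3 from rfl, Nat.squarefree_mul (by norm_num)]
      exact ⟨Nat.prime_two.squarefree, Nat.prime_three.squarefree⟩) (by norm_num) (by simpa using hp)
  have nq : ∀ r : ℚ, (r : ℝ) ≠ q :=
    not_rat_of_sq hz (by omega) (by rw [hq]; push_cast; ring)
  have nw : ∀ r : ℚ, (r : ℝ) ≠ w :=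
    not_rat_of_sq ht (by omega) (by rw [hw]; push_cast; ring)
  have two : ∀ x y : ℚ, (x : ℝ) + y * p = 0 → x = 0 ∧ y = 0 := by
    intro x y hxy
    have hy : y = 0 := by
      by_contra hy
      apply np (-x / y)
      have : (y : ℝ) ≠ 0 := by exact_mod_cast hy
      push_cast
      field_simp
      linarith
    subst hy
    simp at hxy
    exact ⟨hxy, rfl⟩
  have key : ∀ x y : ℚ, q ≠ x + y * p := by
    intro x y hxy
    have h1 : q ^ 2 = ((x ^ 2 + 6 * y ^ 2 : ℚ) : ℝ) + ((2 * x * y : ℚ) : ℝ) * p := by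
      rw [hxy]; push_cast; linear_combination (y : ℝ) ^ 2 * hp
    rw [hq] at h1
    have h2 := (two (x ^ 2 + 6 * y ^ 2 - 2 * z) (2 * x * y) (by
      push_cast at h1 ⊢; linarith)).2
    have h3 : x = 0 ∨ y = 0 := by
      rcases mul_eq_zero.1 h2 with h | h
      · left; linarith
      · right; exact h
    rcases h3 with rfl | rfl
    · apply nw (3 * y)
      push_cast at hxy ⊢
      rw [hxy] at hpq
      linear_combination (1 / 2) * hpq - (y : ℝ) / 2 * hp
    · apply nq x
      rw [hxy]; simp
  -- (a + b p) + (c + d/2 p) q = 0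
  have h' : ((a : ℝ) + b * p) + (c + d / 2 * p) * q = 0 := by
    linear_combination h + (d : ℝ) / 2 * hpq
  by_cases hN : (c ^ 2 - 6 * (d / 2) ^ 2 : ℚ) = 0
  · have hcd : c = 0 ∧ d / 2 = 0 := by
      have : ((c : ℝ) + (d / 2 : ℚ) * p) * (c + (-(d / 2) : ℚ) * p) = 0 := by
        have hN' : ((c ^ 2 - 6 * (d / 2) ^ 2 : ℚ) : ℝ) = 0 := by rw [hN]; simp
        push_cast at hN' ⊢
        linear_combination hN' - (d / 2 : ℝ) ^ 2 * hp
      rcases mul_eq_zero.1 this with h | h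
      · exact two _ _ h
      · have := two _ _ h
        exact ⟨this.1, by linarith [this.2]⟩
    have hd : d = 0 := by linarith [hcd.2]
    have hc := hcd.1
    subst hd hc
    have := two a b (by simpa using h)
    exact ⟨this.1, this.2, rfl, rfl⟩
  · exfalso
    set N : ℚ := c ^ 2 - 6 * (d / 2) ^ 2 with hNd
    have hNr : (N : ℝ) ≠ 0 := by exact_mod_cast hN
    have hNv : (N : ℝ) = c ^ 2 - 6 * (d / 2) ^ 2 := by rw [hNd]; push_cast; ring
    apply key (-(a * c - 6 * b * (d / 2)) / N) (-(b * c - a * (d / 2)) / N)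
    push_cast
    rw [div_mul_eq_mul_div, ← add_div, eq_div_iff hNr, hNv]
    linear_combination (c - d / 2 * p) * h' + (q * (d / 2) ^ 2 + b * (d / 2)) * hp

lemma poly_conj (hp : p ^ 2 = 6) (hq : q ^ 2 = 2 * z) (hw : w ^ 2 = 3 * z) (hpq : p * q = 2 * w)
    (hpw : p * w = 3 * q) (hqw : q * w = z * p)
    (a b c d : ℚ) (P : Polynomial ℤ) : ∃ a' b' c' d' : ℚ, ∀ e f : ℝ, e ^ 2 = 1 → f ^ 2 = 1 →
      Polynomial.aeval (conjRep p q w e f a b c d) P = conjRep p q w e f a' b' c' d' := by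
  induction P using Polynomial.induction_on with
  | C k => exact ⟨k, 0, 0, 0, fun e f _ _ => by simp [conjRep]⟩
  | add P Q h1 h2 =>
    obtain ⟨a1, b1, c1, d1, h1⟩ := h1
    obtain ⟨a2, b2, c2, d2, h2⟩ := h2
    refine ⟨a1 + a2, b1 + b2, c1 + c2, d1 + d2, fun e f he hf => ?_⟩
    rw [map_add, h1 e f he hf, h2 e f he hf]
    simp only [conjRep]; push_cast; ring
  | monomial n k h =>
    obtain ⟨a1, b1, c1, d1, h⟩ := h
    refine ⟨a1 * a + 6 * b1 * b + 2 * z * c1 * c + 3 * z * d1 * d,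
      a1 * b + b1 * a + z * (c1 * d + d1 * c),
      a1 * c + c1 * a + 3 * (b1 * d + d1 * b),
      a1 * d + d1 * a + 2 * (b1 * c + c1 * b), fun e f he hf => ?_⟩
    rw [pow_succ, ← mul_assoc, map_mul, h e f he hf, Polynomial.aeval_X]
    simp only [conjRep]; push_cast
    have e1 : (e * p) ^ 2 = 6 := by rw [mul_pow, he, hp]; ring
    have e2 : (f * q) ^ 2 = 2 * z := by rw [mul_pow, hf, hq]; ring
    have e3 : (e * f * w) ^ 2 = 3 * z := by rw [mul_pow, mul_pow, he, hf, hw]; ring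
    have e4 : (e * p) * (f * q) = 2 * (e * f * w) := by linear_combination e * f * hpq
    have e5 : (e * p) * (e * f * w) = 3 * (f * q) := by
      linear_combination e ^ 2 * f * hpw + 3 * f * q * he
    have e6 : (f * q) * (e * f * w) = z * (e * p) := by
      linear_combination f ^ 2 * e * hqw + z * e * p * hf
    linear_combination (b1 * b : ℝ) * e1 + (c1 * c : ℝ) * e2 + (d1 * d : ℝ) * e3
      + (b1 * c + c1 * b : ℝ) * e4 + (b1 * d + d1 * b : ℝ) * e5 + (c1 * d + d1 * c : ℝ) * e6

lemma integral_form (hz4 : z % 2 = 1) (hz : Squarefree (2 * z)) (ht : Squarefree (3 * z))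
    (hp : p ^ 2 = 6) (hq : q ^ 2 = 2 * z) (hw : w ^ 2 = 3 * z) (hpq : p * q = 2 * w)
    (hpw : p * w = 3 * q) (hqw : q * w = z * p)
    (a b c d : ℚ) (h : IsIntegral ℤ ((a : ℝ) + b * p + c * q + d * w)) :
    ∃ A B C D : ℤ, 2 * a = A ∧ 2 * b = B ∧ 2 * c = C ∧ 2 * d = D ∧
      A % 2 = D % 2 ∧ B % 2 = C % 2 := by
  have s6 : Squarefree 6 := by
      rw [show 6 = 2 * 3 from rfl, Nat.squarefree_mul (by norm_num)]
      exact ⟨Nat.prime_two.squarefree, Nat.prime_three.squarefree⟩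
  have hp' : p ^ 2 = (6 : ℕ) := by simpa using hp
  have hconj : ∀ e f : ℝ, e ^ 2 = 1 → f ^ 2 = 1 → IsIntegral ℤ (conjRep p q w e f a b c d) := by
    obtain ⟨P, hP, hP0⟩ := h
    obtain ⟨a', b', c', d', H⟩ := poly_conj hp hq hw hpq hpw hqw a b c d P
    have h1 := H 1 1 (by norm_num) (by norm_num)
    have h2 : Polynomial.aeval (conjRep p q w 1 1 a b c d) P = 0 := by
      rw [Polynomial.aeval_def]; simpa [conjRep] using hP0
    rw [h2] at h1
    obtain ⟨rfl, rfl, rfl, rfl⟩ := indep hz ht hp hq hw hpq a' b' c' d' (by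
      rw [h1]; simp [conjRep])
    intro e f he hf
    refine ⟨P, hP, ?_⟩
    rw [← Polynomial.aeval_def, H e f he hf]
    simp [conjRep]
  have h1 := hconj 1 1 (by norm_num) (by norm_num)
  have h2 := hconj 1 (-1) (by norm_num) (by norm_num)
  have h3 := hconj (-1) 1 (by norm_num) (by norm_num)
  have h4 := hconj (-1) (-1) (by norm_num) (by norm_num)
  obtain ⟨A, B, hA, hB⟩ := quad_int' s6 (by norm_num) hp' (2 * a) (2 * b)
    (by refine isInt_congr (h1.add h2) ?_; simp only [conjRep]; push_cast; ring)
    (by refine isInt_congr (h3.add h4) ?_; simp only [conjRep]; push_cast; ring)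
  obtain ⟨A', C, hA', hC⟩ := quad_int' hz (by omega) (p := q) (by rw [hq]; push_cast; ring)
    (2 * a) (2 * c)
    (by refine isInt_congr (h1.add h3) ?_; simp only [conjRep]; push_cast; ring)
    (by refine isInt_congr (h2.add h4) ?_; simp only [conjRep]; push_cast; ring)
  obtain ⟨A2, D2, hA2, hD2, hdvd⟩ := quad_int_s14 ht (p := w) (by rw [hw]; push_cast; ring)
    (2 * a) (2 * d)
    (by refine isInt_congr (h1.add h4) ?_; simp only [conjRep]; push_cast; ring)
    (by refine isInt_congr (h2.add h3) ?_; simp only [conjRep]; push_cast; ring)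
  obtain ⟨j, hj⟩ : ∃ j : ℤ, (z : ℤ) = 2 * j + 1 := ⟨z / 2, by omega⟩
  have hD2e : Even D2 := by
    have hA22 : A2 = 2 * A := by
      have : (A2 : ℚ) = 2 * A := by rw [← hA2, hA]
      exact_mod_cast this
    by_contra hc
    rw [Int.not_even_iff_odd] at hc
    obtain ⟨y, rfl⟩ := hc
    obtain ⟨n, hn⟩ := hdvd
    push_cast at hn
    rw [hA22, hj] at hn
    have : 2 * (2 * A ^ 2 - 2 * n - 3 * (2 * j + 1) * (2 * y ^ 2 + 2 * y) - 3 * j - 1) = 1 := by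
      linarith
    omega
  obtain ⟨D, hD⟩ := hD2e
  have hDD : 2 * d = D := by
    rw [hD] at hD2; push_cast at hD2; linarith
  -- relative norm
  obtain ⟨M, N, hM, hN⟩ := quad_int' s6 (by norm_num) hp'
    (a ^ 2 + 6 * b ^ 2 - 2 * z * c ^ 2 - 3 * z * d ^ 2) (2 * a * b - 2 * z * c * d)
    (by
      refine isInt_congr (h1.mul h2) ?_; simp only [conjRep]; push_cast
      linear_combination (-b ^ 2 : ℝ) * hp + (c ^ 2 : ℝ) * hq + (d ^ 2 : ℝ) * hw
        + (2 * c * d : ℝ) * hqw)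
    (by
      refine isInt_congr (h3.mul h4) ?_; simp only [conjRep]; push_cast
      linear_combination (-b ^ 2 : ℝ) * hp + (c ^ 2 : ℝ) * hq + (d ^ 2 : ℝ) * hw
        - (2 * c * d : ℝ) * hqw)
  refine ⟨A, B, C, D, hA, hB, hC, hDD, ?_⟩
  have f1 : A ^ 2 + 6 * B ^ 2 - 2 * z * C ^ 2 - 3 * z * D ^ 2 = 4 * M := by
    have : (A : ℚ) ^ 2 + 6 * B ^ 2 - 2 * z * C ^ 2 - 3 * z * D ^ 2 = 4 * M := by
      rw [← hA, ← hB, ← hC, ← hDD, ← hM]; ring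
    exact_mod_cast this
  have f2 : A * B - z * C * D = 2 * N := by
    have : (A : ℚ) * B - z * C * D = 2 * N := by
      rw [← hA, ← hB, ← hC, ← hDD, ← hN]; ring
    exact_mod_cast this
  rw [hj] at f1 f2
  have hAD : A % 2 = D % 2 := by
    rcases Int.emod_two_eq_zero_or_one A with h | h <;>
    rcases Int.emod_two_eq_zero_or_one D with h' | h' <;> rw [h, h']
    · exfalso
      obtain ⟨x, rfl⟩ : ∃ x, A = 2 * x := ⟨A / 2, by omega⟩
      obtain ⟨y, rfl⟩ : ∃ y, D = 2 * y + 1 := ⟨D / 2, by omega⟩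
      have : 2 * (2 * x ^ 2 + 3 * B ^ 2 - (2 * j + 1) * C ^ 2
        - 3 * (2 * j + 1) * (2 * y ^ 2 + 2 * y) - 3 * j - 1 - 2 * M) = 1 := by linarith
      omega
    · exfalso
      obtain ⟨x, rfl⟩ : ∃ x, A = 2 * x + 1 := ⟨A / 2, by omega⟩
      obtain ⟨y, rfl⟩ : ∃ y, D = 2 * y := ⟨D / 2, by omega⟩
      have : 2 * (-(2 * x ^ 2 + 2 * x + 3 * B ^ 2 - (2 * j + 1) * C ^ 2
        - 3 * (2 * j + 1) * (2 * y ^ 2) - 2 * M)) = 1 := by linarith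
      omega
  refine ⟨hAD, ?_⟩
  rcases Int.emod_two_eq_zero_or_one A with h | h
  · obtain ⟨x, rfl⟩ : ∃ x, A = 2 * x := ⟨A / 2, by omega⟩
    obtain ⟨y, rfl⟩ : ∃ y, D = 2 * y := ⟨D / 2, by omega⟩
    rcases Int.emod_two_eq_zero_or_one B with h | h <;>
    rcases Int.emod_two_eq_zero_or_one C with h' | h' <;> rw [h, h']
    · exfalso
      obtain ⟨u, rfl⟩ : ∃ x, B = 2 * x := ⟨B / 2, by omega⟩
      obtain ⟨v, rfl⟩ : ∃ y, C = 2 * y + 1 := ⟨C / 2, by omega⟩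
      have : 2 * (x ^ 2 + 6 * u ^ 2 - (2 * j + 1) * (2 * v ^ 2 + 2 * v) - j
        - 3 * (2 * j + 1) * y ^ 2 - M) = 1 := by linarith
      omega
    · exfalso
      obtain ⟨u, rfl⟩ : ∃ x, B = 2 * x + 1 := ⟨B / 2, by omega⟩
      obtain ⟨v, rfl⟩ : ∃ y, C = 2 * y := ⟨C / 2, by omega⟩
      have : 2 * (-(x ^ 2 + 6 * u ^ 2 + 6 * u + 1 - (2 * j + 1) * (2 * v ^ 2)
        - 3 * (2 * j + 1) * y ^ 2 - M)) = 1 := by linarith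
      omega
  · obtain ⟨x, rfl⟩ : ∃ x, A = 2 * x + 1 := ⟨A / 2, by omega⟩
    obtain ⟨y, rfl⟩ : ∃ y, D = 2 * y + 1 := ⟨D / 2, by omega⟩
    have : B - C = 2 * (N - x * B + j * C + 2 * j * C * y + C * y) := by linarith
    omega
end setup

lemma core_aux (a x y : ℤ) (h : a ^ 2 + (1 - a) ^ 2 + x ^ 2 + y ^ 2 = 4) : False := by
  have h1 : a ≤ 2 := by nlinarith [sq_nonneg x, sq_nonneg y]
  have h2 : -1 ≤ a := by nlinarith [sq_nonneg x, sq_nonneg y]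
  have h3 : x ≤ 2 := by nlinarith [sq_nonneg a, sq_nonneg (1 - a), sq_nonneg y]
  have h4 : -2 ≤ x := by nlinarith [sq_nonneg a, sq_nonneg (1 - a), sq_nonneg y]
  have h5 : y ≤ 2 := by nlinarith [sq_nonneg a, sq_nonneg (1 - a), sq_nonneg x]
  have h6 : -2 ≤ y := by nlinarith [sq_nonneg a, sq_nonneg (1 - a), sq_nonneg x]
  interval_cases a <;> interval_cases x <;> interval_cases y <;> omega

lemma core (A1 A2 A3 A4 A5 B1 B2 B3 B4 B5 : ℤ) (hA : A1 + A2 = 2) (hB : B1 + B2 = 2)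
    (p1 : A1 % 2 = 0) (p2 : A2 % 2 = 0) (p3 : A3 % 2 = 0) (p4 : A4 % 2 = 0) (p5 : A5 % 2 = 0)
    (q1 : B1 % 2 = 1) (q3 : B3 % 2 = 0) (q4 : B4 % 2 = 0) (q5 : B5 % 2 = 0)
    (h1 : A1 * B1 + A2 * B2 + A3 * B3 + A4 * B4 + A5 * B5 = 6)
    (h2 : A1 ^ 2 + A2 ^ 2 + A3 ^ 2 + A4 ^ 2 + A5 ^ 2
      + 6 * (B1 ^ 2 + B2 ^ 2 + B3 ^ 2 + B4 ^ 2 + B5 ^ 2) = 56) : False := by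
  obtain ⟨a1, rfl⟩ : ∃ x, A1 = 2 * x := ⟨A1 / 2, by omega⟩
  obtain ⟨a3, rfl⟩ : ∃ x, A3 = 2 * x := ⟨A3 / 2, by omega⟩
  obtain ⟨a4, rfl⟩ : ∃ x, A4 = 2 * x := ⟨A4 / 2, by omega⟩
  obtain ⟨a5, rfl⟩ : ∃ x, A5 = 2 * x := ⟨A5 / 2, by omega⟩
  obtain ⟨b3, rfl⟩ : ∃ x, B3 = 2 * x := ⟨B3 / 2, by omega⟩
  obtain ⟨b4, rfl⟩ : ∃ x, B4 = 2 * x := ⟨B4 / 2, by omega⟩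
  obtain ⟨b5, rfl⟩ : ∃ x, B5 = 2 * x := ⟨B5 / 2, by omega⟩
  obtain ⟨m, rfl⟩ : ∃ x, B1 = 2 * x + 1 := ⟨B1 / 2, by omega⟩
  obtain rfl : A2 = 2 * (1 - a1) := by omega
  obtain rfl : B2 = 1 - 2 * m := by omega
  have hm : m = 0 := by
    have : m ^ 2 < 1 := by
      nlinarith [sq_nonneg a1, sq_nonneg (1 - a1), sq_nonneg a3, sq_nonneg a4, sq_nonneg a5,
        sq_nonneg b3, sq_nonneg b4, sq_nonneg b5]
    nlinarith
  subst hm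
  have g1 : a3 * b3 + a4 * b4 + a5 * b5 = 1 := by linarith
  have g2 : a1 ^ 2 + (1 - a1) ^ 2 + a3 ^ 2 + a4 ^ 2 + a5 ^ 2
    + 6 * (b3 ^ 2 + b4 ^ 2 + b5 ^ 2) = 11 := by linarith
  have g3 : b3 ^ 2 + b4 ^ 2 + b5 ^ 2 ≤ 1 := by
    have : 6 * (b3 ^ 2 + b4 ^ 2 + b5 ^ 2) ≤ 11 := by
      linarith [sq_nonneg a1, sq_nonneg (1 - a1), sq_nonneg a3, sq_nonneg a4, sq_nonneg a5]
    omega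
  have bd : ∀ x : ℤ, x ^ 2 ≤ 1 → -1 ≤ x ∧ x ≤ 1 := fun x hx =>
    ⟨by nlinarith, by nlinarith⟩
  obtain ⟨u3, v3⟩ := bd b3 (by linarith [sq_nonneg b4, sq_nonneg b5])
  obtain ⟨u4, v4⟩ := bd b4 (by linarith [sq_nonneg b3, sq_nonneg b5])
  obtain ⟨u5, v5⟩ := bd b5 (by linarith [sq_nonneg b3, sq_nonneg b4])
  clear h1 h2 p1 p2 p3 p4 p5 q1 q3 q4 q5 hA hB bd
  interval_cases b3 <;> interval_cases b4 <;> interval_cases b5 <;>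
    first | (norm_num at g3; done) | (norm_num at g1; done) | norm_num at g1 g2
  · obtain rfl : a3 = -1 := by linarith
    exact core_aux a1 a4 a5 (by linarith)
  · obtain rfl : a4 = -1 := by linarith
    exact core_aux a1 a3 a5 (by linarith)
  · obtain rfl : a5 = -1 := by linarith
    exact core_aux a1 a3 a4 (by linarith)
  · obtain rfl : a5 = 1 := by linarith
    exact core_aux a1 a3 a4 (by linarith)
  · obtain rfl : a4 = 1 := by linarith
    exact core_aux a1 a3 a5 (by linarith)
  · obtain rfl : a3 = 1 := by linarith
    exact core_aux a1 a4 a5 (by linarith)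

lemma no_five (z : ℤ) (hz : 59 ≤ z) (A B C D : Fin 5 → ℤ) (hAD : ∀ i, A i % 2 = D i % 2)
    (hBC : ∀ i, B i % 2 = C i % 2) (hC : ∀ i, 0 ≤ C i)
    (e1 : ∑ i, (A i ^ 2 + 6 * B i ^ 2 + 2 * z * C i ^ 2 + 3 * z * D i ^ 2) = 56 + 4 * z)
    (e2 : ∑ i, (A i * B i + z * (C i * D i)) = 6)
    (e3 : ∑ i, (A i * C i + 3 * (B i * D i)) = 2)
    (e4 : ∑ i, (A i * D i + 2 * (B i * C i)) = 4) : False := by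
  have hsum : 2 * ∑ i, C i ^ 2 + 3 * ∑ i, D i ^ 2 ≤ 4 := by
    have h1 : 0 ≤ ∑ i, (A i ^ 2 + 6 * B i ^ 2) := Finset.sum_nonneg fun i _ => by positivity
    have h2 : z * (2 * ∑ i, C i ^ 2 + 3 * ∑ i, D i ^ 2) ≤ 56 + 4 * z := by
      rw [← e1]
      simp only [Finset.sum_add_distrib, ← Finset.mul_sum] at h1 ⊢
      linarith
    by_contra hc
    push Not at hc
    nlinarith
  have hC0 : 0 ≤ ∑ i, C i ^ 2 := Finset.sum_nonneg fun i _ => sq_nonneg _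
  have hD0 : 0 ≤ ∑ i, D i ^ 2 := Finset.sum_nonneg fun i _ => sq_nonneg _
  have hCle : ∀ i, C i ^ 2 ≤ ∑ i, C i ^ 2 := fun i =>
    Finset.single_le_sum (f := fun i => C i ^ 2) (fun i _ => sq_nonneg _) (Finset.mem_univ i)
  have hDle : ∀ i, D i ^ 2 ≤ ∑ i, D i ^ 2 := fun i =>
    Finset.single_le_sum (f := fun i => D i ^ 2) (fun i _ => sq_nonneg _) (Finset.mem_univ i)
  rcases eq_or_lt_of_le hD0 with hD | hD
  · have hDz : ∀ i, D i = 0 := fun i => by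
      have := hDle i
      rw [← hD] at this
      exact pow_eq_zero_iff (two_ne_zero) |>.1 (le_antisymm this (sq_nonneg _))
    have hsum0 := hsum
    simp only [hDz] at e1 e2 e3 e4 hAD hsum
    have hC1 : ∀ i, C i ≤ 1 := fun i => by
      have := hCle i
      nlinarith
    simp only [Fin.sum_univ_five] at e1 e2 e3 e4 hsum
    have c0 := hC 0
    have c1 := hC 1
    have c2 := hC 2
    have c3 := hC 3
    have c4 := hC 4
    have d0 := hC1 0
    have d1 := hC1 1
    have d2 := hC1 2
    have d3 := hC1 3
    have d4 := hC1 4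
    have b0 := hBC 0
    have b1 := hBC 1
    have b2 := hBC 2
    have b3 := hBC 3
    have b4 := hBC 4
    have a0 := hAD 0
    have a1 := hAD 1
    have a2 := hAD 2
    have a3 := hAD 3
    have a4 := hAD 4
    clear hsum0 hC hC1 hBC hAD hCle hDle hC0 hD0 hD hDz
    generalize A 0 = A0, A 1 = A1, A 2 = A2, A 3 = A3, A 4 = A4 at *
    generalize B 0 = B0, B 1 = B1, B 2 = B2, B 3 = B3, B 4 = B4 at *
    generalize C 0 = C0, C 1 = C1, C 2 = C2, C 3 = C3, C 4 = C4 at *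
    generalize D 0 = D0, D 1 = D1, D 2 = D2, D 3 = D3, D 4 = D4 at *
    interval_cases C0 <;> interval_cases C1 <;> interval_cases C2 <;> interval_cases C3 <;>
      interval_cases C4 <;>
      first
      | omega
      | exact core A0 A1 A2 A3 A4 B0 B1 B2 B3 B4
          (by omega) (by omega) (by omega) (by omega) (by omega) (by omega) (by omega) (by omega)
          (by omega) (by omega) (by omega) (by linarith) (by linarith)
      | exact core A0 A2 A1 A3 A4 B0 B2 B1 B3 B4
          (by omega) (by omega) (by omega) (by omega) (by omega) (by omega) (by omega) (by omega)
          (by omega) (by omega) (by omega) (by linarith) (by linarith)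
      | exact core A0 A3 A2 A1 A4 B0 B3 B2 B1 B4
          (by omega) (by omega) (by omega) (by omega) (by omega) (by omega) (by omega) (by omega)
          (by omega) (by omega) (by omega) (by linarith) (by linarith)
      | exact core A0 A4 A2 A3 A1 B0 B4 B2 B3 B1
          (by omega) (by omega) (by omega) (by omega) (by omega) (by omega) (by omega) (by omega)
          (by omega) (by omega) (by omega) (by linarith) (by linarith)
      | exact core A1 A2 A0 A3 A4 B1 B2 B0 B3 B4
          (by omega) (by omega) (by omega) (by omega) (by omega) (by omega) (by omega) (by omega)
          (by omega) (by omega) (by omega) (by linarith) (by linarith)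
      | exact core A1 A3 A2 A0 A4 B1 B3 B2 B0 B4
          (by omega) (by omega) (by omega) (by omega) (by omega) (by omega) (by omega) (by omega)
          (by omega) (by omega) (by omega) (by linarith) (by linarith)
      | exact core A1 A4 A2 A3 A0 B1 B4 B2 B3 B0
          (by omega) (by omega) (by omega) (by omega) (by omega) (by omega) (by omega) (by omega)
          (by omega) (by omega) (by omega) (by linarith) (by linarith)
      | exact core A2 A3 A0 A1 A4 B2 B3 B0 B1 B4
          (by omega) (by omega) (by omega) (by omega) (by omega) (by omega) (by omega) (by omega)
          (by omega) (by omega) (by omega) (by linarith) (by linarith)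
      | exact core A2 A4 A0 A3 A1 B2 B4 B0 B3 B1
          (by omega) (by omega) (by omega) (by omega) (by omega) (by omega) (by omega) (by omega)
          (by omega) (by omega) (by omega) (by linarith) (by linarith)
      | exact core A3 A4 A0 A1 A2 B3 B4 B0 B1 B2
          (by omega) (by omega) (by omega) (by omega) (by omega) (by omega) (by omega) (by omega)
          (by omega) (by omega) (by omega) (by linarith) (by linarith)
  · have hCz : ∀ i, C i = 0 := fun i => by
      have := hCle i
      exact pow_eq_zero_iff (two_ne_zero) |>.1 (le_antisymm (by omega) (sq_nonneg _))
    simp only [hCz, mul_zero, zero_add, ← Finset.mul_sum] at e3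
    omega

lemma no_five' (z : ℤ) (hz : 59 ≤ z) (A B C D : Fin 5 → ℤ) (hAD : ∀ i, A i % 2 = D i % 2)
    (hBC : ∀ i, B i % 2 = C i % 2)
    (e1 : ∑ i, (A i ^ 2 + 6 * B i ^ 2 + 2 * z * C i ^ 2 + 3 * z * D i ^ 2) = 56 + 4 * z)
    (e2 : ∑ i, (A i * B i + z * (C i * D i)) = 6)
    (e3 : ∑ i, (A i * C i + 3 * (B i * D i)) = 2)
    (e4 : ∑ i, (A i * D i + 2 * (B i * C i)) = 4) : False := by
  have hs : ∀ i, ∃ g : ℤ, (g = 1 ∨ g = -1) ∧ 0 ≤ g * C i := fun i => by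
    rcases le_total 0 (C i) with h | h
    · exact ⟨1, Or.inl rfl, by linarith⟩
    · exact ⟨-1, Or.inr rfl, by linarith⟩
  choose g hg hgC using hs
  have hg2 : ∀ i, g i ^ 2 = 1 := fun i => by rcases hg i with h | h <;> rw [h] <;> norm_num
  refine no_five z hz (fun i => g i * A i) (fun i => g i * B i) (fun i => g i * C i)
    (fun i => g i * D i) ?_ ?_ hgC ?_ ?_ ?_ ?_
  · intro i
    have := hAD i
    rcases hg i with h | h <;> simp only [h] <;> omega
  · intro i
    have := hBC i
    rcases hg i with h | h <;> simp only [h] <;> omega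
  · rw [← e1]; refine Finset.sum_congr rfl fun i _ => ?_
    linear_combination (A i ^ 2 + 6 * B i ^ 2 + 2 * z * C i ^ 2 + 3 * z * D i ^ 2) * hg2 i
  · rw [← e2]; refine Finset.sum_congr rfl fun i _ => ?_
    linear_combination (A i * B i + z * (C i * D i)) * hg2 i
  · rw [← e3]; refine Finset.sum_congr rfl fun i _ => ?_
    linear_combination (A i * C i + 3 * (B i * D i)) * hg2 i
  · rw [← e4]; refine Finset.sum_congr rfl fun i _ => ?_
    linear_combination (A i * D i + 2 * (B i * C i)) * hg2 i

section main
variable {z : ℕ} {p q w : ℝ}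

lemma mem_form (hp : p ^ 2 = 6) (hq : q ^ 2 = 2 * z) (hw : w ^ 2 = 3 * z) (hpq : p * q = 2 * w)
    (hpw : p * w = 3 * q) (hqw : q * w = z * p) (x : ℝ)
    (hx : x ∈ IntermediateField.adjoin ℚ ({p, q} : Set ℝ)) :
    ∃ a b c d : ℚ, x = a + b * p + c * q + d * w := by
  have halg : ∀ y ∈ ({p, q} : Set ℝ), IsAlgebraic ℚ y := by
    intro y hy
    have hi : IsIntegral ℚ y := by
      rcases hy with rfl | rfl
      · refine IsIntegral.of_pow (n := 2) (by norm_num) ?_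
        rw [hp]
        have := isIntegral_algebraMap (R := ℚ) (A := ℝ) (x := (6 : ℚ))
        rwa [show algebraMap ℚ ℝ 6 = 6 by simp] at this
      · refine IsIntegral.of_pow (n := 2) (by norm_num) ?_
        rw [hq]
        have := isIntegral_algebraMap (R := ℚ) (A := ℝ) (x := (2 * z : ℚ))
        rwa [show algebraMap ℚ ℝ (2 * z) = 2 * z by simp] at this
    exact hi.isAlgebraic
  have hx' : x ∈ Algebra.adjoin ℚ ({p, q} : Set ℝ) := by
    rw [← IntermediateField.adjoin_toSubalgebra_of_isAlgebraic halg]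
    exact hx
  have hle : ∀ {y : ℝ}, y ∈ Algebra.adjoin ℚ ({p, q} : Set ℝ) →
      y ∈ IntermediateField.adjoin ℚ ({p, q} : Set ℝ) := fun {y} hy => by
    rw [← IntermediateField.adjoin_toSubalgebra_of_isAlgebraic halg] at hy
    exact hy
  induction hx' using Algebra.adjoin_induction with
  | mem y hy =>
    rcases hy with rfl | rfl
    · exact ⟨0, 1, 0, 0, by simp⟩
    · exact ⟨0, 0, 1, 0, by simp⟩
  | algebraMap r => exact ⟨r, 0, 0, 0, by simp⟩
  | add x y hx0 hy0 h1 h2 =>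
    obtain ⟨a1, b1, c1, d1, h1⟩ := h1 (hle hx0)
    obtain ⟨a2, b2, c2, d2, h2⟩ := h2 (hle hy0)
    refine ⟨a1 + a2, b1 + b2, c1 + c2, d1 + d2, ?_⟩
    rw [h1, h2]; push_cast; ring
  | mul x y hx0 hy0 h1 h2 =>
    obtain ⟨a1, b1, c1, d1, h1⟩ := h1 (hle hx0)
    obtain ⟨a, b, c, d, h2⟩ := h2 (hle hy0)
    refine ⟨a1 * a + 6 * b1 * b + 2 * z * c1 * c + 3 * z * d1 * d,
      a1 * b + b1 * a + z * (c1 * d + d1 * c),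
      a1 * c + c1 * a + 3 * (b1 * d + d1 * b),
      a1 * d + d1 * a + 2 * (b1 * c + c1 * b), ?_⟩
    rw [h1, h2]; push_cast
    linear_combination (b1 * b : ℝ) * hp + (c1 * c : ℝ) * hq + (d1 * d : ℝ) * hw
      + (b1 * c + c1 * b : ℝ) * hpq + (b1 * d + d1 * b : ℝ) * hpw + (c1 * d + d1 * c : ℝ) * hqw

lemma not_five_s14 (hz59 : 59 ≤ z) (hz4 : z % 2 = 1) (hz : Squarefree (2 * z))
    (ht : Squarefree (3 * z))
    (hp : p ^ 2 = 6) (hq : q ^ 2 = 2 * z) (hw : w ^ 2 = 3 * z) (hpq : p * q = 2 * w)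
    (hpw : p * w = 3 * q) (hqw : q * w = z * p) (x : Fin 5 → ℝ)
    (hx : ∀ i, x i ∈ IntermediateField.adjoin ℚ ({p, q} : Set ℝ))
    (hi : ∀ i, IsIntegral ℤ (x i))
    (h : (1 : ℝ) ^ 2 + 1 ^ 2 + 1 ^ 2 + (1 + p) ^ 2 + ((p + q) / 2) ^ 2
          + (1 + (p + q) / 2) ^ 2 = ∑ i, x i ^ 2) : False := by
  have H : ∀ i, ∃ A B C D : ℤ, x i = (A + B * p + C * q + D * w) / 2 ∧
      A % 2 = D % 2 ∧ B % 2 = C % 2 := by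
    intro i
    obtain ⟨a, b, c, d, hx1⟩ := mem_form hp hq hw hpq hpw hqw (x i) (hx i)
    have hi1 := hi i
    rw [hx1] at hi1
    obtain ⟨A, B, C, D, hA, hB, hC, hD, h1, h2⟩ :=
      integral_form hz4 hz ht hp hq hw hpq hpw hqw a b c d hi1
    refine ⟨A, B, C, D, ?_, h1, h2⟩
    have hA' : (2 : ℝ) * a = A := by exact_mod_cast hA
    have hB' : (2 : ℝ) * b = B := by exact_mod_cast hB
    have hC' : (2 : ℝ) * c = C := by exact_mod_cast hC
    have hD' : (2 : ℝ) * d = D := by exact_mod_cast hD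
    rw [hx1, ← hA', ← hB', ← hC', ← hD']; ring
  choose A B C D hX hAD hBC using H
  have hsq : ∀ i, 4 * x i ^ 2
      = ((A i ^ 2 + 6 * B i ^ 2 + 2 * z * C i ^ 2 + 3 * z * D i ^ 2 : ℤ) : ℝ)
      + 2 * ((A i * B i + z * (C i * D i) : ℤ) : ℝ) * p
      + 2 * ((A i * C i + 3 * (B i * D i) : ℤ) : ℝ) * q
      + 2 * ((A i * D i + 2 * (B i * C i) : ℤ) : ℝ) * w := by
    intro i
    rw [hX i]; push_cast
    linear_combination (B i ^ 2 : ℝ) * hp + (C i ^ 2 : ℝ) * hq + (D i ^ 2 : ℝ) * hw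
      + (2 * B i * C i : ℝ) * hpq + (2 * B i * D i : ℝ) * hpw + (2 * C i * D i : ℝ) * hqw
  have hS : 4 * ∑ i, x i ^ 2
      = ((∑ i, (A i ^ 2 + 6 * B i ^ 2 + 2 * z * C i ^ 2 + 3 * z * D i ^ 2) : ℤ) : ℝ)
      + 2 * ((∑ i, (A i * B i + z * (C i * D i)) : ℤ) : ℝ) * p
      + 2 * ((∑ i, (A i * C i + 3 * (B i * D i)) : ℤ) : ℝ) * q
      + 2 * ((∑ i, (A i * D i + 2 * (B i * C i)) : ℤ) : ℝ) * w := by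
    rw [Finset.mul_sum, Finset.sum_congr rfl fun i _ => hsq i]
    rw [Finset.sum_add_distrib, Finset.sum_add_distrib, Finset.sum_add_distrib,
      ← Finset.sum_mul, ← Finset.sum_mul, ← Finset.sum_mul, ← Finset.mul_sum, ← Finset.mul_sum,
      ← Finset.mul_sum]
    simp only [Int.cast_sum]
  have key := no_five' z (by omega) A B C D hAD hBC
  generalize (∑ i, (A i ^ 2 + 6 * B i ^ 2 + 2 * z * C i ^ 2 + 3 * z * D i ^ 2) : ℤ) = S1 at *
  generalize (∑ i, (A i * B i + z * (C i * D i)) : ℤ) = S2 at *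
  generalize (∑ i, (A i * C i + 3 * (B i * D i)) : ℤ) = S3 at *
  generalize (∑ i, (A i * D i + 2 * (B i * C i)) : ℤ) = S4 at *
  rw [← h] at hS
  obtain ⟨k1, k2, k3, k4⟩ := indep hz ht hp hq hw hpq (S1 - (56 + 4 * z)) (2 * S2 - 12)
    (2 * S3 - 4) (2 * S4 - 8) (by
      push_cast
      linear_combination -hS + 6 * hp + 2 * hq + 4 * hpq)
  refine key ?_ ?_ ?_ ?_
  · have : (S1 : ℚ) = 56 + 4 * z := by linarith
    exact_mod_cast this
  · have : (S2 : ℚ) = 6 := by linarith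
    exact_mod_cast this
  · have : (S3 : ℚ) = 2 := by linarith
    exact_mod_cast this
  · have : (S4 : ℚ) = 4 := by linarith
    exact_mod_cast this

end main

lemma pad_len {S : Set ℝ} (h0 : (0 : ℝ) ∈ S) {α : ℝ} {k n : ℕ} (hkn : k ≤ n)
    (h : SumOfSquaresLen S k α) : SumOfSquaresLen S n α := by
  induction n, hkn using Nat.le_induction with
  | base => exact h
  | succ n _ ih =>
    obtain ⟨x, hx, hs⟩ := ih
    refine ⟨Fin.cons 0 x, fun i => ?_, ?_⟩
    · refine Fin.cases ?_ (fun j => ?_) i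
      · simpa using h0
      · simpa using hx j
    · rw [Fin.sum_univ_succ]; simp [hs]

theorem m6_s2_length_six (s : ℕ) (hs4 : s % 4 = 2) (hsf : Squarefree s)
    (hs118 : 118 ≤ s) (h6 : Nat.gcd 6 s = 2) :
    sqLength (ringOfInt 6 (s : ℝ))
        ((1 : ℝ) ^ 2 + 1 ^ 2 + 1 ^ 2 + (1 + Real.sqrt 6) ^ 2
          + ((Real.sqrt 6 + Real.sqrt s) / 2) ^ 2
          + (1 + (Real.sqrt 6 + Real.sqrt s) / 2) ^ 2) = 6 ∧
    6 ≤ pythagorasNumber (ringOfInt 6 (s : ℝ)) := by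
  obtain ⟨z, rfl⟩ : ∃ z, s = 2 * z := ⟨s / 2, by omega⟩
  have hz3 : Nat.Coprime 3 z := by
    rw [Nat.Prime.coprime_iff_not_dvd Nat.prime_three]
    rintro ⟨k, rfl⟩
    have : 6 ∣ Nat.gcd 6 (2 * (3 * k)) := Nat.dvd_gcd (dvd_refl _) ⟨k, by ring⟩
    rw [h6] at this
    omega
  have ht : Squarefree (3 * z) := by
    rw [Nat.squarefree_mul hz3]
    exact ⟨Nat.prime_three.squarefree, hsf.squarefree_of_dvd ⟨2, by ring⟩⟩
  have hp : Real.sqrt 6 ^ 2 = 6 := Real.sq_sqrt (by norm_num)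
  have hq : Real.sqrt ((2 * z : ℕ) : ℝ) ^ 2 = 2 * z := by
    rw [Real.sq_sqrt (by positivity)]; push_cast; ring
  have hring : ringOfInt 6 ((2 * z : ℕ) : ℝ) = {x : ℝ | x ∈ IntermediateField.adjoin ℚ
      ({Real.sqrt 6, Real.sqrt ((2 * z : ℕ) : ℝ)} : Set ℝ) ∧ IsIntegral ℤ x} := rfl
  generalize ringOfInt 6 ((2 * z : ℕ) : ℝ) = S at *
  generalize Real.sqrt 6 = p at *
  generalize Real.sqrt ((2 * z : ℕ) : ℝ) = q at *
  obtain ⟨w, hw0⟩ : ∃ w : ℝ, w = p * q / 2 := ⟨_, rfl⟩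
  have hpq : p * q = 2 * w := by linarith
  have hw : w ^ 2 = 3 * z := by
    rw [hw0]; linear_combination (q ^ 2 / 4) * hp + 3 / 2 * hq
  have hpw : p * w = 3 * q := by rw [hw0]; linear_combination (q / 2) * hp
  have hqw : q * w = z * p := by rw [hw0]; linear_combination (p / 2) * hq
  subst hring
  set S : Set ℝ := {x : ℝ | x ∈ IntermediateField.adjoin ℚ ({p, q} : Set ℝ) ∧ IsIntegral ℤ x}
    with hS
  set α : ℝ := (1 : ℝ) ^ 2 + 1 ^ 2 + 1 ^ 2 + (1 + p) ^ 2 + ((p + q) / 2) ^ 2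
          + (1 + (p + q) / 2) ^ 2 with hα
  have h0 : (0 : ℝ) ∈ S := ⟨zero_mem _, isIntegral_zero⟩
  have h1 : (1 : ℝ) ∈ S := ⟨one_mem _, isIntegral_one⟩
  have hadd : ∀ x y, x ∈ S → y ∈ S → x + y ∈ S := fun x y hx hy =>
    ⟨add_mem hx.1 hy.1, hx.2.add hy.2⟩
  have natInt : ∀ n : ℕ, IsIntegral ℤ (n : ℝ) := fun n => by
    have := isIntegral_algebraMap (R := ℤ) (A := ℝ) (x := (n : ℤ))
    rwa [show algebraMap ℤ ℝ n = n by simp] at this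
  have pm : p ∈ IntermediateField.adjoin ℚ ({p, q} : Set ℝ) :=
    IntermediateField.subset_adjoin _ _ (by simp)
  have qm : q ∈ IntermediateField.adjoin ℚ ({p, q} : Set ℝ) :=
    IntermediateField.subset_adjoin _ _ (by simp)
  have hpS : p ∈ S := by
    refine ⟨pm, IsIntegral.of_pow (n := 2) (by norm_num) ?_⟩
    rw [hp]; exact_mod_cast natInt 6
  have wI : IsIntegral ℤ w := by
    refine IsIntegral.of_pow (n := 2) (by norm_num) ?_
    rw [hw]; exact_mod_cast natInt (3 * z)
  have hyS : (p + q) / 2 ∈ S := by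
    refine ⟨div_mem (add_mem pm qm) (ofNat_mem _ 2), ?_⟩
    refine IsIntegral.of_pow (n := 2) (by norm_num) ?_
    obtain ⟨j, hj⟩ : ∃ j : ℕ, 3 + z = 2 * j := ⟨(3 + z) / 2, by omega⟩
    have hj' : (3 : ℝ) + z = 2 * j := by exact_mod_cast hj
    refine isInt_congr ((natInt j).add wI) ?_
    linear_combination (1 / 4) * hp + (1 / 4) * hq + (1 / 2) * hpq + (1 / 2) * hj'
  have six : SumOfSquaresLen S 6 α := by
    refine ⟨![1, 1, 1, 1 + p, (p + q) / 2, 1 + (p + q) / 2], fun i => ?_, ?_⟩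
    · fin_cases i
      · exact h1
      · exact h1
      · exact h1
      · exact hadd _ _ h1 hpS
      · exact hyS
      · exact hadd _ _ h1 hyS
    · rw [Fin.sum_univ_six]; rfl
  have nfive : ∀ k : ℕ, SumOfSquaresLen S k α → 6 ≤ k := by
    intro k hk
    by_contra hc
    obtain ⟨x, hx, hs⟩ := pad_len h0 (show k ≤ 5 by omega) hk
    exact not_five_s14 (by omega) (by omega) hsf ht hp hq hw hpq hpw hqw x (fun i => (hx i).1)
      (fun i => (hx i).2) hs
  have hlen : sqLength S α = 6 := by
    apply le_antisymm
    · exact sInf_le ⟨6, rfl, six⟩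
    · refine le_sInf ?_
      rintro n ⟨k, rfl, hk⟩
      exact_mod_cast nfive k hk
  refine ⟨hlen, ?_⟩
  rw [← hlen]
  exact le_sSup ⟨α, ⟨6, six⟩, rfl⟩
end
end
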